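/- arXiv:0810.5036 — 3 statements merged into one kernel-verified Lean document; each statement's English description precedes it below -/
import Mathlib

section
/- Dehn twists in the mapping class group of the torus are primitive. Concretely, under the identification Mod(S_1) ≅ SL(2,ℤ) the Dehn twist corresponds to the elementary matrix T = [[1,1],[0,1]], and for every integer k ≥ 2 there is no matrix M in SL(2,ℤ) with M^k = T. -/
/-- Powers of an upper triangular `2 × 2` matrix with constant diagonal. -/
theorem Matrix.upperTriangular_pow_succ {R : Type*} [CommRing R] (a b : R) (n : ℕ) :
    !![a, b; 0, a] ^ (n + 1) = !![a ^ (n + 1), (n + 1) * (a ^ n * b); 0, a ^ (n + 1)] := by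
  induction n with
  | zero => simp
  | succ n ih =>
    rw [pow_succ, ih, Matrix.mul_fin_two]
    push_cast
    ext i j
    fin_cases i <;> fin_cases j <;> simp <;> ring

/-- A matrix commuting with `!![1, 1; 0, 1]` is upper triangular with constant diagonal. -/
theorem Matrix.eq_upperTriangular_of_commute {R : Type*} [CommRing R]
    {A : Matrix (Fin 2) (Fin 2) R} (h : Commute A !![1, 1; 0, 1]) :
    A = !![A 0 0, A 0 1; 0, A 0 0] := by
  have h' := h.eq
  rw [Matrix.eta_fin_two A, Matrix.mul_fin_two, Matrix.mul_fin_two] at h'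
  have h00 := congrFun (congrFun h' 0) 0
  have h01 := congrFun (congrFun h' 0) 1
  simp at h00 h01
  ext i j
  fin_cases i <;> fin_cases j <;> simp <;> grind

/-- Under the identification `Mod(S₁) ≅ SL(2,ℤ)`, a Dehn twist corresponds to the
elementary matrix `T = !![1,1; 0,1]`.  Dehn twists in the mapping class group of the
torus are primitive: for every integer `k ≥ 2` there is no `M ∈ SL(2,ℤ)` with `M ^ k = T`. -/
theorem dehn_twist_primitive_in_SL2Z (k : ℕ) (hk : 2 ≤ k) :
    ¬ ∃ M : Matrix.SpecialLinearGroup (Fin 2) ℤ,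
      M ^ k = (⟨!![1, 1; 0, 1], by norm_num [Matrix.det_fin_two_of]⟩ :
        Matrix.SpecialLinearGroup (Fin 2) ℤ) := by
  rintro ⟨M, hM⟩
  have hT : (M : Matrix (Fin 2) (Fin 2) ℤ) ^ k = !![1, 1; 0, 1] := by
    rw [← Matrix.SpecialLinearGroup.coe_pow, hM]
  obtain ⟨n, rfl⟩ : ∃ n, k = n + 1 := ⟨k - 1, by omega⟩
  have hcomm : Commute (M : Matrix (Fin 2) (Fin 2) ℤ) !![1, 1; 0, 1] :=
    hT ▸ Commute.self_pow _ _
  rw [Matrix.eq_upperTriangular_of_commute hcomm, Matrix.upperTriangular_pow_succ] at hT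
  have h01 := congrFun (congrFun hT 0) 1
  simp at h01
  have hdvd : (n + 1 : ℤ) ∣ 1 := Dvd.intro _ h01
  have := Int.le_of_dvd one_pos hdvd
  omega
end

section
/- The endomorphism φ of the free group F_3 on generators x_1, x_2, x_3 determined by x_1 ↦ x_1·x_3, x_2 ↦ x_3⁻¹·x_2·x_3, x_3 ↦ x_3⁻¹·x_2 is an automorphism of F_3, and φ² is the Nielsen transformation determined by x_1 ↦ x_1·x_2, x_2 ↦ x_2, x_3 ↦ x_3. In particular, the Nielsen transformation has a square root in Aut(F_3). -/
open FreeGroup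

/-- The values of the endomorphism `φ` of `F₃` on the generators:
`x₁ ↦ x₁·x₃`, `x₂ ↦ x₃⁻¹·x₂·x₃`, `x₃ ↦ x₃⁻¹·x₂`. -/
def phiGen : Fin 3 → FreeGroup (Fin 3) :=
  ![of 0 * of 2, (of 2)⁻¹ * of 1 * of 2, (of 2)⁻¹ * of 1]

/-- The values of the Nielsen transformation of `F₃` on the generators:
`x₁ ↦ x₁·x₂`, `x₂ ↦ x₂`, `x₃ ↦ x₃`. -/
def nielsenGen : Fin 3 → FreeGroup (Fin 3) :=
  ![of 0 * of 1, of 1, of 2]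

theorem lift_phiGen_comp_self :
    (FreeGroup.lift phiGen).comp (FreeGroup.lift phiGen) = FreeGroup.lift nielsenGen := by
  ext i
  fin_cases i <;> simp [phiGen, nielsenGen, mul_assoc]

theorem bijective_lift_nielsenGen : Function.Bijective (FreeGroup.lift nielsenGen) := by
  let ψ : FreeGroup (Fin 3) →* FreeGroup (Fin 3) :=
    FreeGroup.lift ![of 0 * (of 1)⁻¹, of 1, of 2]
  have left : ψ.comp (FreeGroup.lift nielsenGen) = MonoidHom.id _ := by
    ext i
    fin_cases i <;> simp [ψ, nielsenGen]
  have right : (FreeGroup.lift nielsenGen).comp ψ = MonoidHom.id _ := by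
    ext i
    fin_cases i <;> simp [ψ, nielsenGen]
  exact Function.bijective_iff_has_inverse.mpr
    ⟨ψ, DFunLike.congr_fun left, DFunLike.congr_fun right⟩

/-- The endomorphism `φ` of the free group `F₃` determined by `x₁ ↦ x₁·x₃`,
`x₂ ↦ x₃⁻¹·x₂·x₃`, `x₃ ↦ x₃⁻¹·x₂` is an automorphism, and `φ²` is the Nielsen
transformation determined by `x₁ ↦ x₁·x₂`, `x₂ ↦ x₂`, `x₃ ↦ x₃`.  In particular,
the Nielsen transformation has a square root in `Aut(F₃)`. -/
theorem nielsen_has_square_root_in_AutF3 :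
    Function.Bijective (FreeGroup.lift phiGen) ∧
    (FreeGroup.lift phiGen).comp (FreeGroup.lift phiGen) = FreeGroup.lift nielsenGen := by
  have h : Function.Bijective (FreeGroup.lift phiGen ∘ FreeGroup.lift phiGen) := by
    rw [← MonoidHom.coe_comp, lift_phiGen_comp_self]
    exact bijective_lift_nielsenGen
  exact ⟨⟨h.injective.of_comp, h.surjective.of_comp⟩, lift_phiGen_comp_self⟩
end

section
/- For every integer n ≥ 3, the Nielsen transformation has a square root in Aut(F_n): there exists an automorphism φ of the free group F_n on generators x_1, …, x_n such that φ² is the automorphism determined by x_1 ↦ x_1·x_2 and x_k ↦ x_k for all 2 ≤ k ≤ n. -/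
open FreeGroup

/-- The endomorphism of a free group sending `a ↦ w`, `b ↦ c⁻¹ * b * c`, `c ↦ c⁻¹ * b` and
fixing all other generators. -/
def conjTwist {α : Type*} [DecidableEq α] (a b c : α) (w : FreeGroup α) :
    FreeGroup α →* FreeGroup α :=
  lift fun i => if i = a then w else if i = b then (of c)⁻¹ * of b * of c
    else if i = c then (of c)⁻¹ * of b else of i

section

variable {α : Type*} [DecidableEq α] {a b c : α}

theorem conjTwist_of_fst (w : FreeGroup α) : conjTwist a b c w (of a) = w := by
  simp [conjTwist]

theorem conjTwist_of_snd (hab : a ≠ b) (w : FreeGroup α) :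
    conjTwist a b c w (of b) = (of c)⁻¹ * of b * of c := by
  simp [conjTwist, hab.symm]

theorem conjTwist_of_thd (hac : a ≠ c) (hbc : b ≠ c) (w : FreeGroup α) :
    conjTwist a b c w (of c) = (of c)⁻¹ * of b := by
  simp [conjTwist, hac.symm, hbc.symm]

theorem conjTwist_of_ne (w : FreeGroup α) {i : α} (ha : i ≠ a) (hb : i ≠ b) (hc : i ≠ c) :
    conjTwist a b c w (of i) = of i := by
  simp [conjTwist, ha, hb, hc]

theorem conjTwist_conjTwist_of (hab : a ≠ b) (hac : a ≠ c) (hbc : b ≠ c) (v w : FreeGroup α)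
    (i : α) : conjTwist a b c v (conjTwist a b c w (of i)) =
      if i = a then conjTwist a b c v w else of i := by
  by_cases ha : i = a
  · subst ha
    simp [conjTwist_of_fst]
  by_cases hb : i = b
  · subst hb
    simp [ha, conjTwist_of_snd hab, conjTwist_of_thd hac hbc, mul_assoc]
  by_cases hc : i = c
  · subst hc
    simp [ha, conjTwist_of_snd hab, conjTwist_of_thd hac hbc, mul_assoc]
  simp [ha, conjTwist_of_ne _ ha hb hc]

/-- The automorphism of a free group sending `a ↦ a * c`, `b ↦ c⁻¹ * b * c`, `c ↦ c⁻¹ * b` and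
fixing all other generators. -/
def nielsenSqrt (hab : a ≠ b) (hac : a ≠ c) (hbc : b ≠ c) : FreeGroup α ≃* FreeGroup α :=
  MonoidHom.toMulEquiv (conjTwist a b c (of a * of c))
    (conjTwist a b c (of a * (of b)⁻¹ * of c))
    (by
      ext i
      rw [MonoidHom.comp_apply, conjTwist_conjTwist_of hab hac hbc]
      split_ifs with h
      · simp [h, conjTwist_of_fst, conjTwist_of_thd hac hbc, mul_assoc]
      · rfl)
    (by
      ext i
      rw [MonoidHom.comp_apply, conjTwist_conjTwist_of hab hac hbc]
      split_ifs with h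
      · simp [h, conjTwist_of_fst, conjTwist_of_snd hab, conjTwist_of_thd hac hbc, mul_assoc]
      · rfl)

theorem nielsenSqrt_nielsenSqrt_of (hab : a ≠ b) (hac : a ≠ c) (hbc : b ≠ c) (i : α) :
    nielsenSqrt hab hac hbc (nielsenSqrt hab hac hbc (of i)) =
      if i = a then of a * of b else of i := by
  refine (conjTwist_conjTwist_of hab hac hbc _ _ i).trans ?_
  simp [conjTwist_of_fst, conjTwist_of_thd hac hbc, mul_assoc]

end

/-- For every integer `n ≥ 3`, the Nielsen transformation has a square root in
`Aut(Fₙ)`: there is an automorphism `φ` of the free group on `n` generators such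
that `φ²` is the automorphism determined by `x₁ ↦ x₁·x₂` and `x_k ↦ x_k` for `k ≥ 2`. -/
theorem nielsen_has_square_root_in_AutFn (n : ℕ) (hn : 3 ≤ n) :
    ∃ φ : FreeGroup (Fin n) ≃* FreeGroup (Fin n),
      ∀ i : Fin n,
        φ (φ (of i)) = if i = ⟨0, by omega⟩ then of (⟨0, by omega⟩ : Fin n) * of ⟨1, by omega⟩
          else of i :=
  ⟨nielsenSqrt (a := ⟨0, by omega⟩) (b := ⟨1, by omega⟩) (c := ⟨2, by omega⟩)
    (by simp) (by simp) (by simp), nielsenSqrt_nielsenSqrt_of _ _ _⟩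
end
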